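/- Let r₀ > 0, let k be an integer, and let f : [r₀,∞) → ℝ be a smooth function that vanishes for all sufficiently large r and satisfies the Robin boundary condition r₀ f'(r₀) + |k| f(r₀) = 0. Then ∫_{r₀}^∞ (Δ_k f)(r) f(r) r dr = − ∫_{r₀}^∞ ( f'(r) + (|k|/r) f(r) )² r dr, and in particular ∫_{r₀}^∞ (Δ_k f)(r) f(r) r dr ≤ 0. -/

import Mathlib

open MeasureTheory Set

/-- The radial operator `Δ_k f(r) = (1/r) (d/dr)(r f'(r)) − (k²/r²) f(r)`. -/
noncomputable def Δk (k : ℤ) (f : ℝ → ℝ) (r : ℝ) : ℝ :=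
  (1 / r) * deriv (fun s => s * deriv f s) r - ((k : ℝ) ^ 2 / r ^ 2) * f r

/-- A function continuous on `[a, ∞)` that vanishes near infinity is integrable on `(a, ∞)`. -/
lemma integrableOn_Ioi_of_continuousOn_of_eq_zero {g : ℝ → ℝ} {a R : ℝ}
    (hg : ContinuousOn g (Ici a)) (hR : ∀ r > R, g r = 0) : IntegrableOn g (Ioi a) := by
  have h : IntegrableOn g (Icc a R) :=
    (hg.mono Icc_subset_Ici_self).integrableOn_Icc
  refine h.of_forall_sdiff_eq_zero measurableSet_Ioi fun r hr => hR r ?_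
  by_contra! hle
  exact hr.2 ⟨(mem_Ioi.1 hr.1).le, hle⟩

/-- Dissipativity of `Δ_k` under the Robin boundary condition
`r₀ f'(r₀) + |k| f(r₀) = 0`: the quadratic form is a negative sum of squares,
`∫_{r₀}^∞ (Δ_k f) f r dr = − ∫_{r₀}^∞ (f' + (|k|/r) f)² r dr ≤ 0`. -/
theorem stmt_4 (r₀ : ℝ) (hr₀ : 0 < r₀) (k : ℤ) (f : ℝ → ℝ)
    (hf : ContDiff ℝ (⊤ : ℕ∞) f) (hvan : ∃ R : ℝ, ∀ r ≥ R, f r = 0)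
    (hrob : r₀ * deriv f r₀ + (|k| : ℝ) * f r₀ = 0) :
    (∫ r in Ioi r₀, Δk k f r * f r * r =
        -(∫ r in Ioi r₀, (deriv f r + ((|k| : ℝ) / r) * f r) ^ 2 * r))
      ∧ ∫ r in Ioi r₀, Δk k f r * f r * r ≤ 0 := by
  obtain ⟨R, hR⟩ := hvan
  have hf1 : ContDiff ℝ (⊤ : ℕ∞) (deriv f) := (contDiff_infty_iff_deriv.1 hf).2
  have hf2 : ContDiff ℝ (⊤ : ℕ∞) (deriv (deriv f)) := (contDiff_infty_iff_deriv.1 hf1).2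
  have hd0 (r : ℝ) : HasDerivAt f (deriv f r) r :=
    (contDiff_infty_iff_deriv.1 hf).1.differentiableAt.hasDerivAt
  have hd1 (r : ℝ) : HasDerivAt (deriv f) (deriv (deriv f) r) r :=
    (contDiff_infty_iff_deriv.1 hf1).1.differentiableAt.hasDerivAt
  have hflux (r : ℝ) :
      HasDerivAt (fun s => s * deriv f s) (deriv f r + r * deriv (deriv f) r) r := by
    exact ((hasDerivAt_id' r).mul (hd1 r)).congr_deriv (by ring)
  have hΔ : Δk k f = fun r => (1 / r) * (deriv f r + r * deriv (deriv f) r)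
      - ((k : ℝ) ^ 2 / r ^ 2) * f r := by
    funext r
    rw [Δk, (hflux r).deriv]
  have hc0 := hf.continuous
  have hc1 := hf1.continuous
  have hc2 := hf2.continuous
  have hne : ∀ r ∈ Ici r₀, r ≠ 0 := fun r hr => (hr₀.trans_le hr).ne'
  have hne2 : ∀ r ∈ Ici r₀, r ^ 2 ≠ 0 := fun r hr => pow_ne_zero 2 (hne r hr)
  have hR' : ∀ r > R, deriv f r = 0 := fun r hr => by
    have h : f =ᶠ[nhds r] fun _ => 0 := by
      filter_upwards [Ioi_mem_nhds hr] with s hs using hR s (mem_Ioi.1 hs).le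
    simpa using h.deriv_eq
  have hint1 : IntegrableOn (fun r => Δk k f r * f r * r) (Ioi r₀) := by
    refine integrableOn_Ioi_of_continuousOn_of_eq_zero (R := R) ?_ fun r hr => by
      simp [hR r hr.le]
    rw [hΔ]
    fun_prop (disch := assumption)
  have hint2 : IntegrableOn (fun r => (deriv f r + (|(k : ℝ)| / r) * f r) ^ 2 * r) (Ioi r₀) := by
    refine integrableOn_Ioi_of_continuousOn_of_eq_zero (R := R) ?_ fun r hr => by
      simp [hR r hr.le, hR' r hr]
    fun_prop (disch := assumption)
  have hG (r : ℝ) (hr : r ∈ Ici r₀) :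
      HasDerivAt (fun s => (s * deriv f s + |(k : ℝ)| * f s) * f s)
        (Δk k f r * f r * r + (deriv f r + (|(k : ℝ)| / r) * f r) ^ 2 * r) r := by
    refine (((hflux r).add ((hd0 r).const_mul |(k : ℝ)|)).mul (hd0 r)).congr_deriv ?_
    have := hne r hr
    rw [hΔ, ← sq_abs (k : ℝ)]
    simp only [Pi.add_apply]
    field_simp
    ring
  have hlim : Filter.Tendsto (fun s => (s * deriv f s + |(k : ℝ)| * f s) * f s)
      Filter.atTop (nhds 0) := by
    refine tendsto_const_nhds.congr' ?_
    filter_upwards [Filter.eventually_ge_atTop R] with s hs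
    simp [hR s hs]
  have key := integral_Ioi_of_hasDerivAt_of_tendsto' hG (hint1.add hint2) hlim
  rw [integral_add hint1 hint2, hrob, zero_mul, sub_zero] at key
  have heq := eq_neg_of_add_eq_zero_left key
  refine ⟨heq, heq.trans_le (neg_nonpos.2 (setIntegral_nonneg measurableSet_Ioi fun r hr => ?_))⟩
  exact mul_nonneg (sq_nonneg _) (hr₀.trans hr).le
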